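/- For any ℓ ≥ 1 and any finite graph H, the number of distinct edges of H that belong to some irreducible ℓ-coil of H is at most ℓ · #_c(H), where #_c(H) is the cycle number of H. -/

import Mathlib

open SimpleGraph Set

variable {V : Type*} [Fintype V] [DecidableEq V]

/-- The cycle number of a graph: the minimum number of edges whose removal leaves an
acyclic graph. -/
noncomputable def cycleNumber (G : SimpleGraph V) : ℕ :=
  sInf {k : ℕ | ∃ s : Finset (Sym2 V), ↑s ⊆ G.edgeSet ∧ s.card = k ∧
    (G.deleteEdges (↑s : Set (Sym2 V))).IsAcyclic}

/-- An `ℓ`-coil: a set of at most `ℓ` edges forming a connected graph (on its incident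
vertices) with at least two cycles (cycle number ≥ 2). -/
def IsCoil (ℓ : ℕ) (C : Finset (Sym2 V)) : Prop :=
  C.card ≤ ℓ ∧
  ((SimpleGraph.fromEdgeSet (↑C : Set (Sym2 V))).induce
      (SimpleGraph.fromEdgeSet (↑C : Set (Sym2 V))).support).Connected ∧
  2 ≤ cycleNumber (SimpleGraph.fromEdgeSet (↑C : Set (Sym2 V)))

/-- An irreducible `ℓ`-coil: no proper subset of its edges is an `ℓ`-coil. -/
def IsIrreducibleCoil (ℓ : ℕ) (C : Finset (Sym2 V)) : Prop :=
  IsCoil ℓ C ∧ ∀ C' : Finset (Sym2 V), C' ⊂ C → ¬ IsCoil ℓ C'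

set_option linter.unusedSectionVars false

/-- The set of endpoints of a finite set of edges. -/
def endpoints (X : Finset (Sym2 V)) : Finset V := X.biUnion Sym2.toFinset

theorem mem_endpoints {X : Finset (Sym2 V)} {v : V} :
    v ∈ endpoints X ↔ ∃ e ∈ X, v ∈ e := by
  simp [endpoints]

theorem endpoints_mono {X Y : Finset (Sym2 V)} (h : X ⊆ Y) : endpoints X ⊆ endpoints Y :=
  Finset.biUnion_subset_biUnion_of_subset_left _ h

theorem card_endpoints_union_add_inter_le (X Y : Finset (Sym2 V)) :
    (endpoints (X ∪ Y)).card + (endpoints (X ∩ Y)).card ≤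
      (endpoints X).card + (endpoints Y).card := by
  have hunion : endpoints (X ∪ Y) = endpoints X ∪ endpoints Y := Finset.union_biUnion
  rw [hunion, ← Finset.card_union_add_card_inter (endpoints X)]
  gcongr
  exact Finset.subset_inter (endpoints_mono Finset.inter_subset_left)
    (endpoints_mono Finset.inter_subset_right)

theorem coe_endpoints_eq_support {X : Finset (Sym2 V)} (hX : ∀ e ∈ X, ¬ e.IsDiag) :
    (endpoints X : Set V) = (fromEdgeSet (X : Set (Sym2 V))).support := by
  ext v
  simp only [Finset.mem_coe, mem_endpoints, SimpleGraph.mem_support, fromEdgeSet_adj]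
  constructor
  · rintro ⟨e, he, w, rfl⟩
    exact ⟨w, he, fun h => hX _ he (by simpa using h)⟩
  · rintro ⟨w, hw, -⟩
    exact ⟨_, hw, Sym2.mem_mk_left _ _⟩

/-- A nonempty set of vertices carrying all edges of a forest has more elements than the forest
has edges. -/
theorem card_add_one_le_card_of_isAcyclic {X : Finset (Sym2 V)} (hX : ∀ e ∈ X, ¬ e.IsDiag)
    (hac : (fromEdgeSet (X : Set (Sym2 V))).IsAcyclic) {S : Finset V} (hS : S.Nonempty)
    (hXS : endpoints X ⊆ S) : X.card + 1 ≤ S.card := by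
  classical
  have : Nonempty S := hS.to_subtype
  obtain ⟨T, hT, -, htree⟩ := (connected_top (V := S)).exists_isTree_le_of_le_of_isAcyclic
    le_top (hac.induce (S : Set V))
  have hcard := htree.card_edgeFinset
  rw [Fintype.card_coe] at hcard
  rw [← hcard]
  gcongr
  have hsub : X ⊆ T.edgeFinset.image (Sym2.map Subtype.val) := by
    intro e he
    induction e with
    | h a b =>
      have ha : a ∈ S := hXS (mem_endpoints.2 ⟨_, he, Sym2.mem_mk_left _ _⟩)
      have hb : b ∈ S := hXS (mem_endpoints.2 ⟨_, he, Sym2.mem_mk_right _ _⟩)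
      refine Finset.mem_image.2 ⟨s(⟨a, ha⟩, ⟨b, hb⟩), ?_, by simp⟩
      rw [mem_edgeFinset, mem_edgeSet]
      apply hT
      simp only [comap_adj, fromEdgeSet_adj]
      exact ⟨he, fun h => hX _ he (by simpa using h)⟩
  exact (Finset.card_le_card hsub).trans Finset.card_image_le

theorem exists_isAcyclic_card_eq_cycleNumber (G : SimpleGraph V) :
    ∃ s : Finset (Sym2 V), ↑s ⊆ G.edgeSet ∧ s.card = cycleNumber G ∧
      (G.deleteEdges (s : Set (Sym2 V))).IsAcyclic := by
  classical
  refine Nat.sInf_mem (s := {k : ℕ | ∃ s : Finset (Sym2 V), ↑s ⊆ G.edgeSet ∧ s.card = k ∧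
    (G.deleteEdges (↑s : Set (Sym2 V))).IsAcyclic}) ⟨_, G.edgeFinset, by simp, rfl, ?_⟩
  have hbot : G.deleteEdges (G.edgeFinset : Set (Sym2 V)) = ⊥ := by
    ext a b
    simp
  rw [hbot]
  exact isAcyclic_bot

theorem not_isDiag_of_subset_edgeSet {H : SimpleGraph V} {X : Finset (Sym2 V)}
    (hX : ↑X ⊆ H.edgeSet) : ∀ e ∈ X, ¬ e.IsDiag :=
  fun _ he => H.not_isDiag_of_mem_edgeSet (hX he)

/-- The edges of a graph outnumber their endpoints by at most the cycle number. -/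
theorem card_le_card_endpoints_add_cycleNumber {H : SimpleGraph V} {X : Finset (Sym2 V)}
    (hX : ↑X ⊆ H.edgeSet) (hne : X.Nonempty) :
    X.card + 1 ≤ (endpoints X).card + cycleNumber H := by
  obtain ⟨s, -, hcard, hac⟩ := exists_isAcyclic_card_eq_cycleNumber H
  have hloop := not_isDiag_of_subset_edgeSet hX
  have hforest : (fromEdgeSet (↑(X \ s) : Set (Sym2 V))).IsAcyclic := by
    refine hac.anti fun a b hab => ?_
    simp only [fromEdgeSet_adj, Finset.coe_sdiff, Set.mem_sdiff, Finset.mem_coe] at hab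
    rw [deleteEdges_adj]
    exact ⟨hX hab.1.1, hab.1.2⟩
  have hends : (endpoints X).Nonempty := by
    obtain ⟨e, he⟩ := hne
    induction e with
    | h a b => exact ⟨a, mem_endpoints.2 ⟨_, he, Sym2.mem_mk_left _ _⟩⟩
  have := card_add_one_le_card_of_isAcyclic
    (fun e he => hloop e (Finset.sdiff_subset he)) hforest hends
    (endpoints_mono Finset.sdiff_subset)
  have := Finset.le_card_sdiff s X
  omega

theorem IsCoil.card_endpoints_lt {ℓ : ℕ} {C : Finset (Sym2 V)} (hC : IsCoil ℓ C)
    (hloop : ∀ e ∈ C, ¬ e.IsDiag) : (endpoints C).card < C.card := by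
  classical
  obtain ⟨-, hconn, hcyc⟩ := hC
  set G := fromEdgeSet (C : Set (Sym2 V)) with hG
  obtain ⟨F, -, hFG, hF, hreach⟩ :=
    G.exists_isAcyclic_reachable_eq_le_of_le_of_isAcyclic bot_le isAcyclic_bot
  have hwalk : ∀ {u v : V} (_ : F.Walk u v) (hu : u ∈ G.support) (hv : v ∈ G.support),
      (F.induce G.support).Reachable ⟨u, hu⟩ ⟨v, hv⟩ := by
    intro u v p
    induction p with
    | nil => exact fun _ _ => Reachable.rfl
    | cons h p ih =>
      intro hu hv
      have hw := G.mem_support.2 ⟨_, (hFG h).symm⟩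
      refine Reachable.trans (Adj.reachable ?_) (ih hw hv)
      simpa using h
  have hFconn : (F.induce G.support).Connected := by
    have := hconn.nonempty
    refine Connected.mk fun a b => ?_
    have hab : G.Reachable a b := (hconn.preconnected a b).map (Embedding.induce _).toHom
    rw [← hreach] at hab
    obtain ⟨p⟩ := hab
    exact hwalk p a.2 b.2
  have hcard := hFconn.card_vert_le_card_edgeSet_add_one
  have hsupp : Nat.card G.support = (endpoints C).card := by
    rw [hG, ← coe_endpoints_eq_support hloop]
    simp
  have hedges : Nat.card (F.induce G.support).edgeSet ≤ F.edgeFinset.card := by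
    rw [edgeFinset_card, ← Nat.card_eq_fintype_card]
    exact Nat.card_le_card_of_injective _
      (Embedding.mapEdgeSet (Embedding.induce (G := F) G.support)).injective
  have hFC : F.edgeFinset ⊆ C := by
    intro e he
    have := edgeSet_mono hFG (mem_edgeFinset.1 he)
    rw [hG, edgeSet_fromEdgeSet] at this
    exact this.1
  have hle : cycleNumber G ≤ (C \ F.edgeFinset).card := by
    refine Nat.sInf_le ⟨C \ F.edgeFinset, ?_, rfl, ?_⟩
    · intro e he
      rw [hG, edgeSet_fromEdgeSet]
      rw [Finset.mem_coe, Finset.mem_sdiff] at he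
      exact ⟨he.1, hloop e he.1⟩
    · refine hF.anti fun a b hab => ?_
      simp only [deleteEdges_adj, hG, fromEdgeSet_adj, Finset.coe_sdiff, Set.mem_sdiff,
        Finset.mem_coe, mem_edgeFinset, mem_edgeSet] at hab
      tauto
  rw [Finset.card_sdiff_of_subset hFC] at hle
  omega

/-- A minimal edge set with more edges than endpoints is connected. -/
theorem connected_of_minimal_card_endpoints_lt {X : Finset (Sym2 V)}
    (hloop : ∀ e ∈ X, ¬ e.IsDiag) (hX : (endpoints X).card < X.card)
    (hmin : ∀ Y ⊂ X, Y.card ≤ (endpoints Y).card) :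
    ((fromEdgeSet (X : Set (Sym2 V))).induce
      (fromEdgeSet (X : Set (Sym2 V))).support).Connected := by
  classical
  set G := fromEdgeSet (X : Set (Sym2 V)) with hG
  have hmem : ∀ {a b : V}, s(a, b) ∈ X → G.Adj a b := fun {a b} h =>
    (fromEdgeSet_adj _).2 ⟨h, fun hab => hloop _ h (by simpa using hab)⟩
  have hne : X.Nonempty := Finset.card_pos.1 (by omega)
  obtain ⟨e₀, he₀⟩ := hne
  obtain ⟨u, u', rfl⟩ : ∃ u u', e₀ = s(u, u') := by
    induction e₀ with
    | h u u' => exact ⟨u, u', rfl⟩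
  have hu : u ∈ G.support := ⟨u', hmem he₀⟩
  refine (connected_iff_exists_forall_reachable _).2 ⟨⟨u, hu⟩, ?_⟩
  let P : V → Prop := fun v => ∃ hv : v ∈ G.support, (G.induce G.support).Reachable ⟨u, hu⟩ ⟨v, hv⟩
  have hP : ∀ {a b : V}, G.Adj a b → P a → P b := by
    rintro a b hab ⟨ha, hr⟩
    refine ⟨⟨a, hab.symm⟩, hr.trans (Adj.reachable ?_)⟩
    simpa using hab
  obtain ⟨R, hR⟩ : ∃ R : Finset (Sym2 V), ∀ e, e ∈ R ↔ e ∈ X ∧ ∃ v ∈ e, P v :=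
    ⟨X.filter fun e => ∃ v ∈ e, P v, fun _ => Finset.mem_filter⟩
  have hRP : ∀ e ∈ R, ∀ v ∈ e, P v := by
    rintro e he v ⟨w, rfl⟩
    obtain ⟨hm, x, hx, hPx⟩ := (hR _).1 he
    rcases Sym2.mem_iff.1 hx with rfl | rfl
    · exact hPx
    · exact hP (hmem hm).symm hPx
  have hRX : R ⊆ X := fun e he => ((hR e).1 he).1
  have huR : s(u, u') ∈ R :=
    (hR _).2 ⟨he₀, u, Sym2.mem_mk_left _ _, hu, Reachable.rfl⟩
  have hdisj : Disjoint (endpoints R) (endpoints (X \ R)) := by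
    rw [Finset.disjoint_left]
    intro v hv hv'
    obtain ⟨e, he, hve⟩ := mem_endpoints.1 hv
    obtain ⟨e', he', hve'⟩ := mem_endpoints.1 hv'
    rw [Finset.mem_sdiff] at he'
    exact he'.2 ((hR _).2 ⟨he'.1, v, hve', hRP e he v hve⟩)
  have hsum : (endpoints R).card + (endpoints (X \ R)).card ≤ (endpoints X).card := by
    rw [← Finset.card_union_of_disjoint hdisj]
    exact Finset.card_le_card
      (Finset.union_subset (endpoints_mono hRX) (endpoints_mono Finset.sdiff_subset))
  have hRall : R = X := by
    by_contra hRne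
    have h₁ := hmin R (hRX.ssubset_of_ne hRne)
    have h₂ := hmin (X \ R) (Finset.sdiff_ssubset hRX ⟨_, huR⟩)
    have := Finset.card_sdiff_add_card_eq_card hRX
    omega
  rintro ⟨v, w, hvw⟩
  have hvX : s(v, w) ∈ R := hRall ▸ ((fromEdgeSet_adj _).1 hvw).1
  exact (hRP _ hvX v (Sym2.mem_mk_left _ _)).2

theorem IsIrreducibleCoil.card_le_card_endpoints {ℓ : ℕ} {C : Finset (Sym2 V)}
    (hC : IsIrreducibleCoil ℓ C) (hloop : ∀ e ∈ C, ¬ e.IsDiag) (X : Finset (Sym2 V))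
    (hXC : X ⊂ C) : X.card ≤ (endpoints X).card := by
  induction X using Finset.strongInduction with
  | H X ih =>
  by_contra! hlt
  have hloopX : ∀ e ∈ X, ¬ e.IsDiag := fun e he => hloop e (hXC.1 he)
  have hsub : ↑X ⊆ (fromEdgeSet (X : Set (Sym2 V))).edgeSet := by
    intro e he
    rw [edgeSet_fromEdgeSet]
    exact ⟨he, hloopX e he⟩
  have hcyc := card_le_card_endpoints_add_cycleNumber hsub (Finset.card_pos.1 (by omega))
  exact hC.2 X hXC ⟨(Finset.card_le_card hXC.1).trans hC.1.1,
    connected_of_minimal_card_endpoints_lt hloopX hlt fun Y hY => ih Y hY (hY.trans hXC), by omega⟩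

/-- Enlarging an edge set by an irreducible coil not contained in it increases the excess of
edges over endpoints. -/
theorem IsIrreducibleCoil.card_add_card_endpoints_union_lt {ℓ : ℕ} {A C : Finset (Sym2 V)}
    (hC : IsIrreducibleCoil ℓ C) (hloop : ∀ e ∈ C, ¬ e.IsDiag) (hCA : ¬ C ⊆ A) :
    A.card + (endpoints (A ∪ C)).card < (A ∪ C).card + (endpoints A).card := by
  have hss : A ∩ C ⊂ C :=
    Finset.inter_subset_right.ssubset_of_ne fun h => hCA (Finset.inter_eq_right.1 h)
  have h₁ := hC.card_le_card_endpoints hloop _ hss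
  have h₂ := hC.1.card_endpoints_lt hloop
  have h₃ := card_endpoints_union_add_inter_le A C
  have h₄ := Finset.card_union_add_card_inter A C
  omega

theorem card_biUnion_irreducible_coils_le {ℓ : ℕ} (𝒞 : Finset (Finset (Sym2 V)))
    (h𝒞 : ∀ C ∈ 𝒞, IsIrreducibleCoil ℓ C ∧ ∀ e ∈ C, ¬ e.IsDiag) :
    ((𝒞.biUnion id).card : ℤ) ≤
      ℓ * ((𝒞.biUnion id).card - (endpoints (𝒞.biUnion id)).card : ℤ) := by
  induction 𝒞 using Finset.induction_on with
  | empty => simp [endpoints]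
  | insert C 𝒟 _ ih =>
    have ih := ih fun D hD => h𝒞 D (Finset.mem_insert_of_mem hD)
    obtain ⟨hC, hloop⟩ := h𝒞 C (Finset.mem_insert_self _ _)
    rw [Finset.biUnion_insert, id, Finset.union_comm]
    set A := 𝒟.biUnion id
    by_cases hCA : C ⊆ A
    · rwa [Finset.union_eq_left.2 hCA]
    have hlt := hC.card_add_card_endpoints_union_lt hloop hCA
    have hle := (Finset.card_union_le A C).trans (Nat.add_le_add_left hC.1.1 _)
    zify at hlt hle
    have : (ℓ : ℤ) * ((A.card - (endpoints A).card : ℤ) + 1) ≤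
        ℓ * ((A ∪ C).card - (endpoints (A ∪ C)).card : ℤ) := by
      gcongr
      omega
    linarith

/-- The number of distinct edges of a finite graph `H` that belong to some irreducible
`ℓ`-coil of `H` is at most `ℓ · #_c(H)`. -/
theorem card_edges_in_irreducible_coils_le (ℓ : ℕ) (hℓ : 1 ≤ ℓ) (H : SimpleGraph V) :
    ({e : Sym2 V | ∃ C : Finset (Sym2 V), ↑C ⊆ H.edgeSet ∧
        IsIrreducibleCoil ℓ C ∧ e ∈ C}).ncard ≤ ℓ * cycleNumber H := by
  classical
  let 𝒞 : Finset (Finset (Sym2 V)) := Finset.univ.filter fun C =>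
    ↑C ⊆ H.edgeSet ∧ IsIrreducibleCoil ℓ C
  have hset : {e : Sym2 V | ∃ C : Finset (Sym2 V), ↑C ⊆ H.edgeSet ∧
      IsIrreducibleCoil ℓ C ∧ e ∈ C} = ↑(𝒞.biUnion id) := by
    ext e
    simp [𝒞, and_assoc]
  rw [hset, Set.ncard_coe_finset]
  rcases (𝒞.biUnion id).eq_empty_or_nonempty with hempty | hne
  · simp [hempty]
  have hmem : ∀ C ∈ 𝒞, ↑C ⊆ H.edgeSet ∧ IsIrreducibleCoil ℓ C := fun C hC =>
    (Finset.mem_filter.1 hC).2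
  have hsub : ↑(𝒞.biUnion id) ⊆ H.edgeSet := by
    intro e he
    obtain ⟨C, hC, heC⟩ := Finset.mem_biUnion.1 (Finset.mem_coe.1 he)
    exact (hmem C hC).1 heC
  have hcyc := card_le_card_endpoints_add_cycleNumber hsub hne
  have hcoils := card_biUnion_irreducible_coils_le 𝒞 fun C hC =>
    ⟨(hmem C hC).2, not_isDiag_of_subset_edgeSet (hmem C hC).1⟩
  zify at hcyc ⊢
  refine hcoils.trans ?_
  gcongr
  linarith
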